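/- arXiv:1208.2871 — 3 statements merged into one kernel-verified Lean document; each statement's English description precedes it below -/
import Mathlib

section
/- Let n ≥ 2 and let Bⁿ be the open unit ball in ℝⁿ. For x,y ∈ Bⁿ set ρ*(x,y) = arctan(sinh(ρ_{Bⁿ}(x,y)/2)) = arctan(|x−y|/√((1−|x|²)(1−|y|²))). Then for all x,y ∈ Bⁿ one has ρ*(x,y) ≤ v_{Bⁿ}(x,y) ≤ 2·ρ*(x,y). Moreover, equality holds in the left-hand inequality if and only if the points 0, x, y are collinear or x = 0 or y = 0; and the constant 2 on the right is best possible: for every c < 2 there exist distinct points x,y ∈ Bⁿ with v_{Bⁿ}(x,y) > c·ρ*(x,y). -/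
open EuclideanGeometry Real Set

/-- The visual angle metric on a domain `G ⊊ ℝⁿ`:
`v_G(x,y) = sup_{z ∈ ∂G} ∠(x,z,y)`. -/
noncomputable def visualAngle {n : ℕ} (G : Set (EuclideanSpace ℝ (Fin n)))
    (x y : EuclideanSpace ℝ (Fin n)) : ℝ :=
  sSup ((fun z => ∠ x z y) '' frontier G)

/-- The hyperbolic metric of the unit ball:
`ρ_{Bⁿ}(x,y) = 2 arsinh(|x−y|/√((1−|x|²)(1−|y|²)))`. -/
noncomputable def rhoBall {n : ℕ} (x y : EuclideanSpace ℝ (Fin n)) : ℝ :=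
  2 * Real.arsinh (dist x y / Real.sqrt ((1 - ‖x‖ ^ 2) * (1 - ‖y‖ ^ 2)))

/-- `ρ*(x,y) = arctan(sinh(ρ_{Bⁿ}(x,y)/2))`. -/
noncomputable def rhoStarBall {n : ℕ} (x y : EuclideanSpace ℝ (Fin n)) : ℝ :=
  Real.arctan (Real.sinh (rhoBall x y / 2))

section InnerProductSpace

variable {V : Type*} [NormedAddCommGroup V] [InnerProductSpace ℝ V]

lemma two_mul_inner_mul_inner_le (u v w : V) (hw : ‖w‖ = 1) :
    2 * (inner ℝ u w * inner ℝ v w) ≤ ‖u‖ * ‖v‖ + inner ℝ u v := by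
  have hww : inner ℝ w w = (1 : ℝ) := by rw [real_inner_self_eq_norm_sq, hw]; norm_num
  have hn : ‖v - (2 * inner ℝ v w) • w‖ = ‖v‖ := by
    have h : ‖v - (2 * inner ℝ v w) • w‖ ^ 2 = ‖v‖ ^ 2 := by
      rw [← real_inner_self_eq_norm_sq, ← real_inner_self_eq_norm_sq]
      simp only [inner_sub_left, inner_sub_right, inner_smul_left, inner_smul_right, hww,
        real_inner_comm v w, conj_trivial]
      ring
    exact (sq_eq_sq₀ (norm_nonneg _) (norm_nonneg _)).1 h
  have h := neg_le_of_abs_le (abs_real_inner_le_norm u (v - (2 * inner ℝ v w) • w))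
  rw [hn, inner_sub_right, inner_smul_right] at h
  nlinarith

lemma dist_sq_eq_inner (x y : V) :
    dist x y ^ 2 = ‖x‖ ^ 2 - 2 * inner ℝ x y + ‖y‖ ^ 2 := by
  rw [dist_eq_norm, norm_sub_sq_real]

lemma collinear_zero_pair_of_sq_inner_eq {x y : V}
    (h : ‖x‖ ^ 2 * ‖y‖ ^ 2 = inner ℝ x y ^ 2) : Collinear ℝ ({0, x, y} : Set V) := by
  rw [collinear_iff_of_mem (p₀ := (0 : V)) (by simp)]
  by_cases hx : x = 0
  · refine ⟨y, fun p hp => ?_⟩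
    simp only [Set.mem_insert_iff, Set.mem_singleton_iff] at hp
    rcases hp with rfl | rfl | rfl
    · exact ⟨0, by simp⟩
    · exact ⟨0, by simp [hx]⟩
    · exact ⟨1, by simp⟩
  · have hx' : ‖x‖ ^ 2 ≠ 0 := by simpa using hx
    refine ⟨x, fun p hp => ?_⟩
    simp only [Set.mem_insert_iff, Set.mem_singleton_iff] at hp
    rcases hp with rfl | rfl | rfl
    · exact ⟨0, by simp⟩
    · exact ⟨1, by simp⟩
    · refine ⟨inner ℝ x p / ‖x‖ ^ 2, ?_⟩
      have h0 : ‖p - (inner ℝ x p / ‖x‖ ^ 2) • x‖ ^ 2 = 0 := by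
        rw [norm_sub_sq_real, norm_smul, inner_smul_right, real_inner_comm x p, mul_pow,
          Real.norm_eq_abs, sq_abs]
        field_simp
        linarith
      have h1 := sub_eq_zero.1 (norm_eq_zero.1 (pow_eq_zero_iff (two_ne_zero) |>.1 h0))
      simpa using h1

end InnerProductSpace

section Ball

variable {n : ℕ} {x y z : EuclideanSpace ℝ (Fin n)}

lemma one_sub_norm_sq_pos (hx : ‖x‖ < 1) : 0 < 1 - ‖x‖ ^ 2 := by
  nlinarith [norm_nonneg x]

lemma rhoStarBall_eq_arctan (x y : EuclideanSpace ℝ (Fin n)) :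
    rhoStarBall x y = arctan (dist x y / √((1 - ‖x‖ ^ 2) * (1 - ‖y‖ ^ 2))) := by
  rw [rhoStarBall, rhoBall, mul_div_cancel_left₀ _ two_ne_zero, sinh_arsinh]

lemma rhoStarBall_nonneg (x y : EuclideanSpace ℝ (Fin n)) : 0 ≤ rhoStarBall x y := by
  rw [rhoStarBall_eq_arctan]
  exact arctan_nonneg.2 (by positivity)

lemma rhoStarBall_lt_pi_div_two (x y : EuclideanSpace ℝ (Fin n)) :
    rhoStarBall x y < π / 2 := arctan_lt_pi_div_two _

lemma cos_rhoStarBall_pos (x y : EuclideanSpace ℝ (Fin n)) : 0 < cos (rhoStarBall x y) :=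
  cos_arctan_pos _

lemma cos_sq_rhoStarBall_mul (hx : ‖x‖ < 1) (hy : ‖y‖ < 1) :
    cos (rhoStarBall x y) ^ 2 * (dist x y ^ 2 + (1 - ‖x‖ ^ 2) * (1 - ‖y‖ ^ 2)) =
      (1 - ‖x‖ ^ 2) * (1 - ‖y‖ ^ 2) := by
  have hN := mul_pos (one_sub_norm_sq_pos hx) (one_sub_norm_sq_pos hy)
  rw [rhoStarBall_eq_arctan, cos_sq_arctan, div_pow, sq_sqrt hN.le]
  generalize (1 - ‖x‖ ^ 2) * (1 - ‖y‖ ^ 2) = N at hN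
  field_simp
  ring

lemma norm_sub_pos_of_norm_lt_one (hx : ‖x‖ < 1) (hz : ‖z‖ = 1) : 0 < ‖x - z‖ := by
  rw [norm_pos_iff, sub_ne_zero]
  rintro rfl
  linarith

lemma cos_angle_mul (x y z : EuclideanSpace ℝ (Fin n)) :
    cos (∠ x z y) * (‖x - z‖ * ‖y - z‖) = inner ℝ (x - z) (y - z) :=
  InnerProductGeometry.cos_angle_mul_norm_mul_norm _ _

lemma angle_le_two_mul_rhoStarBall (hx : ‖x‖ < 1) (hy : ‖y‖ < 1) (hz : ‖z‖ = 1) :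
    ∠ x z y ≤ 2 * rhoStarBall x y := by
  have hX := one_sub_norm_sq_pos hx
  have hY := one_sub_norm_sq_pos hy
  have ha := norm_sub_pos_of_norm_lt_one hx hz
  have hb := norm_sub_pos_of_norm_lt_one hy hz
  have hcos := cos_angle_mul x y z
  have hk := cos_sq_rhoStarBall_mul hx hy
  have key := two_mul_inner_mul_inner_le (x - z) (y - z) z hz
  have hxz : 1 - ‖x‖ ^ 2 = -2 * inner ℝ (x - z) z - ‖x - z‖ ^ 2 := by
    rw [inner_sub_left, real_inner_self_eq_norm_sq, norm_sub_sq_real, hz]; ring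
  have hyz : 1 - ‖y‖ ^ 2 = -2 * inner ℝ (y - z) z - ‖y - z‖ ^ 2 := by
    rw [inner_sub_left, real_inner_self_eq_norm_sq, norm_sub_sq_real, hz]; ring
  have hD : dist x y ^ 2 = ‖x - z‖ ^ 2 - 2 * inner ℝ (x - z) (y - z) + ‖y - z‖ ^ 2 := by
    rw [← dist_sq_eq_inner, dist_sub_right]
  have hle := cos_le_one (∠ x z y)
  have hge := neg_one_le_cos (∠ x z y)
  by_contra! hlt
  have hc := cos_lt_cos_of_nonneg_of_le_pi
    (mul_nonneg zero_le_two (rhoStarBall_nonneg x y)) (angle_le_pi x z y) hlt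
  rw [cos_two_mul] at hc
  set t := cos (∠ x z y)
  set k := cos (rhoStarBall x y)
  set N := (1 - ‖x‖ ^ 2) * (1 - ‖y‖ ^ 2) with hN
  set a := ‖x - z‖
  set b := ‖y - z‖
  have hNpos : 0 < N := mul_pos hX hY
  have hD1 : 2 * (a * b) * (1 - t) ≤ dist x y ^ 2 := by
    rw [hD, ← hcos]; nlinarith [sq_nonneg (a - b)]
  have hN1 : N ≤ 2 * (a * b) * (1 + t) := by
    have h1 : N ≤ (-2 * inner ℝ (x - z) z) * (-2 * inner ℝ (y - z) z) :=
      mul_le_mul (by nlinarith [sq_nonneg a]) (by nlinarith [sq_nonneg b]) hY.le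
        (by nlinarith [sq_nonneg a])
    nlinarith
  have h2 : N * (1 - t) ≤ dist x y ^ 2 * (1 + t) := by
    nlinarith [mul_le_mul_of_nonneg_right hN1 (sub_nonneg.2 hle),
      mul_le_mul_of_nonneg_right hD1 (by linarith : 0 ≤ 1 + t)]
  have h3 : 0 < dist x y ^ 2 + N := by positivity
  nlinarith [mul_lt_mul_of_pos_right hc h3]

lemma angle_le_visualAngle (hz : ‖z‖ = 1) :
    ∠ x z y ≤ visualAngle (Metric.ball 0 1) x y := by
  refine le_csSup ⟨π, ?_⟩ ⟨z, ?_, rfl⟩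
  · rintro _ ⟨w, -, rfl⟩
    exact angle_le_pi _ _ _
  · rw [frontier_ball _ one_ne_zero]
    simpa using hz

lemma visualAngle_le (hn : 2 ≤ n) {r : ℝ} (h : ∀ z, ‖z‖ = 1 → ∠ x z y ≤ r) :
    visualAngle (Metric.ball 0 1) x y ≤ r := by
  have : Nonempty (Fin n) := ⟨⟨0, by omega⟩⟩
  rw [visualAngle, frontier_ball _ one_ne_zero]
  refine csSup_le ((NormedSpace.sphere_nonempty.2 zero_le_one).image _) ?_
  rintro _ ⟨w, hw, rfl⟩
  exact h w (by simpa using hw)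

set_option maxHeartbeats 1000000 in
lemma exists_rhoStarBall_lt_angle (hx : ‖x‖ < 1) (hy : ‖y‖ < 1)
    (hc : ¬ Collinear ℝ ({0, x, y} : Set (EuclideanSpace ℝ (Fin n)))) :
    ∃ z, ‖z‖ = 1 ∧ rhoStarBall x y < ∠ x z y := by
  have hX := one_sub_norm_sq_pos hx
  have hY := one_sub_norm_sq_pos hy
  have hk := cos_sq_rhoStarBall_mul hx hy
  have hk0 := cos_rhoStarBall_pos x y
  have hDsq := dist_sq_eq_inner x y
  have hP := abs_real_inner_le_norm x y
  have hG : 0 < ‖x‖ ^ 2 * ‖y‖ ^ 2 - inner ℝ x y ^ 2 := by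
    refine lt_of_le_of_ne ?_ fun h => hc (collinear_zero_pair_of_sq_inner_eq (by linarith))
    have := sq_le_sq' (neg_le_of_abs_le hP) (le_of_abs_le hP)
    nlinarith
  obtain ⟨C, hC, hCsq⟩ : ∃ C : ℝ, 0 < C ∧ C ^ 2 = ‖x‖ ^ 2 * ‖y‖ ^ 2 - inner ℝ x y ^ 2 :=
    ⟨_, sqrt_pos.2 hG, sq_sqrt hG.le⟩
  obtain ⟨S, hS, hSsq⟩ : ∃ S : ℝ, 0 < S ∧ S ^ 2 = (1 - ‖x‖ ^ 2) * (1 - ‖y‖ ^ 2) :=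
    ⟨_, sqrt_pos.2 (mul_pos hX hY), sq_sqrt (mul_pos hX hY).le⟩
  have hD : 0 ≤ dist x y := dist_nonneg
  have hX0 := sq_nonneg ‖x‖
  have hP1 : -1 < inner ℝ x y ∧ inner ℝ x y < 1 := by
    rw [← abs_lt]
    exact hP.trans_lt (by nlinarith [norm_nonneg x, norm_nonneg y])
  have hCD : C < dist x y := by
    refine lt_of_pow_lt_pow_left₀ 2 hD ?_
    have h1 : C ^ 2 ≤ ‖x‖ ^ 2 * dist x y ^ 2 := by
      rw [hCsq, hDsq]; nlinarith [sq_nonneg (‖x‖ ^ 2 - inner ℝ x y)]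
    nlinarith [sq_pos_of_pos hC]
  have hSP : S ≤ 1 - inner ℝ x y := by
    refine le_of_sq_le_sq (by nlinarith) (by linarith)
  set D := dist x y with hDdef
  set P : ℝ := inner ℝ x y with hPdef
  obtain ⟨q, hq⟩ : ∃ q, S = q * C := ⟨S / C, by field_simp⟩
  obtain ⟨α, hα⟩ : ∃ α, α = q * (‖y‖ ^ 2 - P) + D := ⟨_, rfl⟩
  obtain ⟨β, hβ⟩ : ∃ β, β = q * (‖x‖ ^ 2 - P) + D := ⟨_, rfl⟩
  obtain ⟨w, hw⟩ : ∃ w, w = α • x + β • y := ⟨_, rfl⟩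
  have inner_lin : ∀ a b : ℝ, inner ℝ x (a • x + b • y) = a * ‖x‖ ^ 2 + b * P := fun a b => by
    rw [inner_add_right, inner_smul_right, inner_smul_right, real_inner_self_eq_norm_sq]
  have inner_lin' : ∀ a b : ℝ, inner ℝ y (a • x + b • y) = a * P + b * ‖y‖ ^ 2 := fun a b => by
    rw [inner_add_right, inner_smul_right, inner_smul_right, real_inner_self_eq_norm_sq,
      real_inner_comm]
  have norm_lin : ∀ a b : ℝ, ‖a • x + b • y‖ ^ 2 = a ^ 2 * ‖x‖ ^ 2 + 2 * a * b * P
      + b ^ 2 * ‖y‖ ^ 2 := fun a b => by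
    rw [← real_inner_self_eq_norm_sq, inner_add_left, inner_smul_left, inner_smul_left, inner_lin,
      inner_lin']
    simp only [conj_trivial]
    ring
  have hwsq : ‖w‖ ^ 2 = D ^ 2 * ((1 + P) ^ 2 + C ^ 2) + 4 * S * D * C := by
    rw [hw, norm_lin, hα, hβ]
    rw [hq] at hSsq ⊢
    linear_combination (-q ^ 2 * (‖x‖ ^ 2 + ‖y‖ ^ 2 - 2 * P) - 4 * q * D - D ^ 2) * hCsq
      - q ^ 2 * C ^ 2 * hDsq + D ^ 2 * hSsq
  have hK : S * C + D * (1 + P) < ‖w‖ := by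
    refine lt_of_pow_lt_pow_left₀ 2 (norm_nonneg _) ?_
    rw [hwsq]
    have : 0 < C * ((D ^ 2 - S ^ 2) * C + 2 * S * D * (1 - P)) := by
      refine mul_pos hC ?_
      have h1 : S * (S * C) < S * (D * (1 - P)) := by
        refine mul_lt_mul_of_pos_left ?_ hS
        nlinarith
      have h2 : 0 < D ^ 2 * C := by have := hC.trans hCD; positivity
      have h3 : 0 < S * D * (1 - P) := by
        have := hC.trans hCD
        have := hS.trans_le hSP
        positivity
      nlinarith
    nlinarith
  have hwpos : 0 < ‖w‖ := lt_trans (by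
    have := hC.trans hCD
    have : 0 < 1 + P := by linarith
    positivity) hK
  have hz : ‖‖w‖⁻¹ • w‖ = 1 := by
    rw [norm_smul, norm_inv, norm_norm, inv_mul_cancel₀ hwpos.ne']
  refine ⟨‖w‖⁻¹ • w, hz, ?_⟩
  have hzlin : ‖w‖⁻¹ • w = (‖w‖⁻¹ * α) • x + (‖w‖⁻¹ * β) • y := by
    rw [hw, smul_add, smul_smul, smul_smul]
  generalize hzdef : ‖w‖⁻¹ • w = z at *
  generalize ha : ‖w‖⁻¹ * α = a at *
  generalize hb : ‖w‖⁻¹ * β = b at *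
  have hz1 := norm_lin a b
  rw [← hzlin, hz] at hz1
  have hxz : inner ℝ x z = a * ‖x‖ ^ 2 + b * P := by rw [hzlin, inner_lin]
  have hyz : inner ℝ y z = a * P + b * ‖y‖ ^ 2 := by rw [hzlin, inner_lin']
  have hp : inner ℝ (x - z) (y - z) = P - inner ℝ x z - inner ℝ y z + 1 := by
    rw [inner_sub_left, inner_sub_right, inner_sub_right, real_inner_self_eq_norm_sq, hz,
      real_inner_comm y z]
    ring
  have hax : ‖x - z‖ ^ 2 = ‖x‖ ^ 2 - 2 * inner ℝ x z + 1 := by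
    rw [norm_sub_sq_real, hz]; ring
  have hay : ‖y - z‖ ^ 2 = ‖y‖ ^ 2 - 2 * inner ℝ y z + 1 := by
    rw [norm_sub_sq_real, hz]; ring
  have hcross : ‖x - z‖ ^ 2 * ‖y - z‖ ^ 2 - inner ℝ (x - z) (y - z) ^ 2
      = (C * (a + b - 1)) ^ 2 := by
    rw [mul_pow, hCsq, hax, hay, hp, hxz, hyz]
    linear_combination (‖x‖ ^ 2 + ‖y‖ ^ 2 - 2 * P) * hz1
  have hf : D * inner ℝ (x - z) (y - z) < S * (C * (a + b - 1)) := by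
    have h1 : S * (C * (a + b - 1)) - D * inner ℝ (x - z) (y - z)
        = ‖w‖ - (S * C + D * (1 + P)) := by
      have h2 : S * C * (a + b) + D * (inner ℝ x z + inner ℝ y z) = ‖w‖ := by
        have h3 : S * C * (α + β) + D * (inner ℝ x w + inner ℝ y w) = ‖w‖ ^ 2 := by
          rw [hwsq, hw, inner_lin, inner_lin', hα, hβ]
          rw [hq] at hSsq ⊢
          linear_combination (-2 * q * D - D ^ 2) * hCsq - q ^ 2 * C ^ 2 * hDsq + D ^ 2 * hSsq
        rw [← hzdef, inner_smul_right, inner_smul_right, ← ha, ← hb]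
        field_simp
        linarith
      rw [hp]
      linarith
    linarith
  have hcos := cos_angle_mul x y z
  have hapos := norm_sub_pos_of_norm_lt_one hx hz
  have hbpos := norm_sub_pos_of_norm_lt_one hy hz
  by_contra! hle
  have hcosle := cos_le_cos_of_nonneg_of_le_pi (angle_nonneg x z y)
    ((rhoStarBall_lt_pi_div_two x y).le.trans (by linarith [pi_pos])) hle
  have hp0 : 0 < inner ℝ (x - z) (y - z) := by
    rw [← hcos]
    have := hk0.trans_le hcosle
    positivity
  have h1 := mul_le_mul_of_nonneg_right hcosle (mul_pos hapos hbpos).le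
  rw [hcos] at h1
  have h2 := pow_le_pow_left₀ (by positivity) h1 2
  have h3 := pow_lt_pow_left₀ hf (by positivity) two_ne_zero
  rw [mul_pow S, ← hcross] at h3
  rw [← hSsq] at hk
  have h4 := mul_le_mul_of_nonneg_right h2 (by positivity : 0 ≤ D ^ 2 + S ^ 2)
  nlinarith

lemma exists_eq_smul_of_collinear (hn : 2 ≤ n)
    (hc : Collinear ℝ ({0, x, y} : Set (EuclideanSpace ℝ (Fin n)))) :
    ∃ (e : EuclideanSpace ℝ (Fin n)) (s t : ℝ), ‖e‖ = 1 ∧ x = s • e ∧ y = t • e := by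
  rw [collinear_iff_of_mem (p₀ := 0) (by simp)] at hc
  obtain ⟨v, hv⟩ := hc
  obtain ⟨s, hs⟩ := hv x (by simp)
  obtain ⟨t, ht⟩ := hv y (by simp)
  simp only [vadd_eq_add, add_zero] at hs ht
  by_cases h : v = 0
  · refine ⟨EuclideanSpace.single ⟨0, by omega⟩ 1, 0, 0, by simp, ?_, ?_⟩ <;> simp [hs, ht, h]
  · have hv0 : ‖v‖ ≠ 0 := by simpa using h
    refine ⟨‖v‖⁻¹ • v, s * ‖v‖, t * ‖v‖, ?_, ?_, ?_⟩
    · rw [norm_smul, norm_inv, norm_norm, inv_mul_cancel₀ hv0]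
    · rw [smul_smul, mul_assoc, mul_inv_cancel₀ hv0, mul_one, hs]
    · rw [smul_smul, mul_assoc, mul_inv_cancel₀ hv0, mul_one, ht]

lemma exists_orthogonal_unit (hn : 2 ≤ n) (e : EuclideanSpace ℝ (Fin n)) :
    ∃ f : EuclideanSpace ℝ (Fin n), ‖f‖ = 1 ∧ inner ℝ e f = (0 : ℝ) := by
  obtain ⟨v, hv0, hv⟩ : ∃ v : EuclideanSpace ℝ (Fin n), v ≠ 0 ∧ inner ℝ e v = (0 : ℝ) := by
    by_contra! h
    have hb : (ℝ ∙ e)ᗮ = ⊥ := by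
      rw [Submodule.eq_bot_iff]
      intro v hv
      by_contra hv0
      exact h v hv0 (Submodule.mem_orthogonal_singleton_iff_inner_right.1 hv)
    have h1 := Submodule.finrank_add_finrank_orthogonal (ℝ ∙ e)
    rw [hb, finrank_bot, finrank_euclideanSpace_fin] at h1
    have h2 : Module.finrank ℝ (ℝ ∙ e) ≤ 1 := by
      simpa using finrank_span_le_card (R := ℝ) ({e} : Set (EuclideanSpace ℝ (Fin n)))
    omega
  have hv1 : ‖v‖ ≠ 0 := by simpa using hv0
  exact ⟨‖v‖⁻¹ • v, by rw [norm_smul, norm_inv, norm_norm, inv_mul_cancel₀ hv1],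
    by rw [inner_smul_right, hv, mul_zero]⟩

section Collinear

variable {e : EuclideanSpace ℝ (Fin n)} {s t : ℝ}

lemma collinear_identity (hs : ‖s • e‖ < 1) (ht : ‖t • e‖ < 1) (he : ‖e‖ = 1) (hz : ‖z‖ = 1) :
    0 < inner ℝ (s • e - z) (t • e - z) ∧
    (1 - s * t) ^ 2 * inner ℝ (s • e - z) (t • e - z) ^ 2 =
      (1 - s ^ 2) * (1 - t ^ 2) * (‖s • e - z‖ * ‖t • e - z‖) ^ 2 +
        (s - t) ^ 2 * (s + t - (1 + s * t) * inner ℝ e z) ^ 2 := by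
  have hp : inner ℝ (s • e - z) (t • e - z) = 1 + s * t - (s + t) * inner ℝ e z := by
    simp only [inner_sub_left, inner_sub_right, inner_smul_left, inner_smul_right,
      real_inner_self_eq_norm_sq, he, hz, real_inner_comm e z, conj_trivial]
    ring
  have ha : ∀ r : ℝ, ‖r • e - z‖ ^ 2 = 1 + r ^ 2 - 2 * r * inner ℝ e z := fun r => by
    rw [norm_sub_sq_real, norm_smul, he, hz, inner_smul_left, mul_pow, Real.norm_eq_abs, sq_abs]
    simp only [conj_trivial]
    ring
  have hc : |inner ℝ e z| ≤ (1 : ℝ) := by simpa [he, hz] using abs_real_inner_le_norm e z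
  rw [norm_smul, he, mul_one, Real.norm_eq_abs, abs_lt] at hs ht
  rw [abs_le] at hc
  refine ⟨?_, ?_⟩
  · rw [hp]
    have h1 : 0 < 1 + s * t - (s + t) := by nlinarith
    have h2 : 0 < 1 + s * t + (s + t) := by nlinarith
    rcases le_total 0 (s + t) with h | h <;> nlinarith
  · rw [mul_pow, ha, ha, hp]
    ring

lemma cos_sq_rhoStarBall_smul (hs : ‖s • e‖ < 1) (ht : ‖t • e‖ < 1) (he : ‖e‖ = 1) :
    cos (rhoStarBall (s • e) (t • e)) ^ 2 * (1 - s * t) ^ 2 = (1 - s ^ 2) * (1 - t ^ 2) := by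
  have h := cos_sq_rhoStarBall_mul hs ht
  have hD : dist (s • e) (t • e) ^ 2 = (s - t) ^ 2 := by
    rw [dist_eq_norm, ← sub_smul, norm_smul, he, mul_one, Real.norm_eq_abs, sq_abs]
  rw [hD, norm_smul, norm_smul, he, mul_one, mul_one, Real.norm_eq_abs, Real.norm_eq_abs, sq_abs,
    sq_abs] at h
  rw [← h]
  ring

lemma angle_le_rhoStarBall_smul (hs : ‖s • e‖ < 1) (ht : ‖t • e‖ < 1) (he : ‖e‖ = 1)
    (hz : ‖z‖ = 1) : ∠ (s • e) z (t • e) ≤ rhoStarBall (s • e) (t • e) := by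
  obtain ⟨hp, hid⟩ := collinear_identity hs ht he hz
  have hk := cos_sq_rhoStarBall_smul hs ht he
  have hcos := cos_angle_mul (s • e) (t • e) z
  have ha := mul_pos (norm_sub_pos_of_norm_lt_one hs hz) (norm_sub_pos_of_norm_lt_one ht hz)
  by_contra! hlt
  have hc := cos_lt_cos_of_nonneg_of_le_pi (rhoStarBall_nonneg _ _) (angle_le_pi _ _ _) hlt
  have h1 := mul_lt_mul_of_pos_right hc ha
  rw [hcos] at h1
  have h2 := pow_lt_pow_left₀ h1 hp.le two_ne_zero
  rw [norm_smul, he, mul_one, Real.norm_eq_abs, abs_lt] at hs ht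
  have hA : 0 < (1 - s * t) ^ 2 := by
    have : 0 < 1 - s * t := by nlinarith
    positivity
  have h3 := mul_lt_mul_of_pos_left h2 hA
  rw [hid, mul_pow (cos _), ← mul_assoc, mul_comm _ (cos _ ^ 2), hk] at h3
  nlinarith [sq_nonneg ((s - t) * (s + t - (1 + s * t) * inner ℝ e z))]

lemma exists_rhoStarBall_smul_le_angle (hn : 2 ≤ n) (hs : ‖s • e‖ < 1) (ht : ‖t • e‖ < 1)
    (he : ‖e‖ = 1) :
    ∃ z, ‖z‖ = 1 ∧ rhoStarBall (s • e) (t • e) ≤ ∠ (s • e) z (t • e) := by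
  obtain ⟨f, hf, hef⟩ := exists_orthogonal_unit hn e
  have hs' := hs
  have ht' := ht
  rw [norm_smul, he, mul_one, Real.norm_eq_abs, abs_lt] at hs' ht'
  have hst : 0 < 1 + s * t := by nlinarith
  have hst' : 0 < 1 - s * t := by nlinarith
  set c := (s + t) / (1 + s * t) with hc
  have hc1 : 0 ≤ 1 - c ^ 2 := by
    rw [hc, div_pow, sub_nonneg, div_le_one (by positivity)]
    nlinarith [mul_pos (by nlinarith : 0 < 1 - s ^ 2) (by nlinarith : 0 < 1 - t ^ 2)]
  have hz : ‖c • e + √(1 - c ^ 2) • f‖ = 1 := by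
    have h : ‖c • e + √(1 - c ^ 2) • f‖ ^ 2 = 1 := by
      rw [norm_add_sq_real, inner_smul_left, inner_smul_right, hef, norm_smul, norm_smul, he, hf,
        mul_one, mul_one, Real.norm_eq_abs, Real.norm_eq_abs, sq_abs, sq_abs, sq_sqrt hc1]
      ring
    exact (pow_eq_one_iff_of_nonneg (norm_nonneg _) two_ne_zero).1 h
  have hez : inner ℝ e (c • e + √(1 - c ^ 2) • f) = c := by
    rw [inner_add_right, inner_smul_right, inner_smul_right, hef, real_inner_self_eq_norm_sq, he]
    ring
  refine ⟨_, hz, ?_⟩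
  obtain ⟨hp, hid⟩ := collinear_identity hs ht he hz
  have h0 : s + t - (1 + s * t) * c = 0 := by rw [hc]; field_simp; ring
  rw [hez, h0] at hid
  set z := c • e + √(1 - c ^ 2) • f
  have hk := cos_sq_rhoStarBall_smul hs ht he
  have hk0 := cos_rhoStarBall_pos (s • e) (t • e)
  have hcos := cos_angle_mul (s • e) (t • e) z
  have ha := mul_pos (norm_sub_pos_of_norm_lt_one hs hz) (norm_sub_pos_of_norm_lt_one ht hz)
  by_contra! hlt
  have hcl := cos_lt_cos_of_nonneg_of_le_pi (angle_nonneg _ _ _)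
    ((rhoStarBall_lt_pi_div_two (s • e) (t • e)).le.trans (by linarith [pi_pos])) hlt
  have h1 := mul_lt_mul_of_pos_right hcl ha
  rw [hcos] at h1
  have h2 := pow_lt_pow_left₀ h1 (by positivity) two_ne_zero
  have h3 := mul_lt_mul_of_pos_left h2 (by positivity : 0 < (1 - s * t) ^ 2)
  rw [hid, mul_pow (cos _), ← mul_assoc, mul_comm _ (cos _ ^ 2), hk] at h3
  linarith

end Collinear

lemma exists_mul_rhoStarBall_lt_visualAngle (hn : 2 ≤ n) {c : ℝ} (hc : c < 2) :
    ∃ x ∈ Metric.ball (0 : EuclideanSpace ℝ (Fin n)) 1,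
      ∃ y ∈ Metric.ball (0 : EuclideanSpace ℝ (Fin n)) 1,
        x ≠ y ∧ c * rhoStarBall x y < visualAngle (Metric.ball 0 1) x y := by
  obtain ⟨e, he⟩ : ∃ e : EuclideanSpace ℝ (Fin n), ‖e‖ = 1 :=
    ⟨EuclideanSpace.single ⟨0, by omega⟩ 1, by simp⟩
  obtain ⟨f, hf, hef⟩ := exists_orthogonal_unit hn e
  obtain ⟨ε, ⟨hε0, hε1⟩, hε⟩ : ∃ ε ∈ Set.Ioo (0 : ℝ) 1, c * arctan (1 / (1 - ε)) < π / 2 := by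
    have hcont : ContinuousAt (fun ε : ℝ => c * arctan (1 / (1 - ε))) 0 := by
      have : ContinuousAt (fun ε : ℝ => 1 / (1 - ε)) 0 :=
        continuousAt_const.div (by fun_prop) (by norm_num)
      exact continuousAt_const.mul (continuous_arctan.continuousAt.comp this)
    have h0 : c * arctan (1 / (1 - 0)) < π / 2 := by
      rw [sub_zero, div_one, arctan_one]
      nlinarith [pi_pos]
    have hev := (hcont.eventually_lt continuousAt_const h0).filter_mono
      (nhdsWithin_le_nhds (s := Set.Ioi 0))
    exact ((Filter.Eventually.and (Ioo_mem_nhdsGT one_pos) hev)).exists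
  have hnorm : ∀ r : ℝ, r ^ 2 = ε ^ 2 → ‖(1 - ε) • e + r • f‖ ^ 2 = 1 - 2 * ε * (1 - ε) := by
    intro r hr
    rw [norm_add_sq_real, inner_smul_left, inner_smul_right, hef, norm_smul, norm_smul, he, hf,
      mul_one, mul_one, Real.norm_eq_abs, Real.norm_eq_abs, sq_abs, sq_abs, hr]
    ring
  have hlt : ∀ r : ℝ, r ^ 2 = ε ^ 2 →
      (1 - ε) • e + r • f ∈ Metric.ball (0 : EuclideanSpace ℝ (Fin n)) 1 := by
    intro r hr
    rw [mem_ball_zero_iff]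
    have := hnorm r hr
    nlinarith [mul_pos hε0 (sub_pos.2 hε1), norm_nonneg ((1 - ε) • e + r • f)]
  have hdist : dist ((1 - ε) • e + ε • f) ((1 - ε) • e + (-ε) • f) = 2 * ε := by
    rw [dist_eq_norm, add_sub_add_left_eq_sub, ← sub_smul, norm_smul, hf, Real.norm_eq_abs,
      abs_of_pos (by linarith)]
    ring
  refine ⟨_, hlt ε rfl, _, hlt (-ε) (neg_sq ε), ?_, ?_⟩
  · rw [← dist_pos, hdist]; linarith
  · have hρ : rhoStarBall ((1 - ε) • e + ε • f) ((1 - ε) • e + (-ε) • f)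
        = arctan (1 / (1 - ε)) := by
      have h1 : 0 < 1 - ε := by linarith
      rw [rhoStarBall_eq_arctan, hdist, hnorm _ rfl, hnorm _ (neg_sq ε), sub_sub_cancel,
        sqrt_mul_self (by positivity)]
      congr 1
      field_simp
    have hangle : ∠ ((1 - ε) • e + ε • f) e ((1 - ε) • e + (-ε) • f) = π / 2 := by
      refine InnerProductGeometry.inner_eq_zero_iff_angle_eq_pi_div_two _ _ |>.1 ?_
      simp only [vsub_eq_sub, inner_sub_left, inner_sub_right, inner_add_left, inner_add_right,
        inner_smul_left, inner_smul_right, real_inner_self_eq_norm_sq, he, hf, hef,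
        real_inner_comm e f, conj_trivial]
      ring
    rw [hρ]
    exact hε.trans_le (hangle ▸ angle_le_visualAngle he)

end Ball

theorem stmt0 (n : ℕ) (hn : 2 ≤ n) :
    (∀ x ∈ Metric.ball (0 : EuclideanSpace ℝ (Fin n)) 1,
      ∀ y ∈ Metric.ball (0 : EuclideanSpace ℝ (Fin n)) 1,
        rhoStarBall x y ≤ visualAngle (Metric.ball 0 1) x y ∧
        visualAngle (Metric.ball 0 1) x y ≤ 2 * rhoStarBall x y ∧
        (rhoStarBall x y = visualAngle (Metric.ball 0 1) x y ↔
          Collinear ℝ ({0, x, y} : Set (EuclideanSpace ℝ (Fin n))) ∨ x = 0 ∨ y = 0)) ∧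
    (∀ c : ℝ, c < 2 →
      ∃ x ∈ Metric.ball (0 : EuclideanSpace ℝ (Fin n)) 1,
        ∃ y ∈ Metric.ball (0 : EuclideanSpace ℝ (Fin n)) 1,
          x ≠ y ∧ c * rhoStarBall x y < visualAngle (Metric.ball 0 1) x y) := by
  refine ⟨fun x hx y hy => ?_, fun c hc => exists_mul_rhoStarBall_lt_visualAngle hn hc⟩
  rw [mem_ball_zero_iff] at hx hy
  have hupper : visualAngle (Metric.ball 0 1) x y ≤ 2 * rhoStarBall x y :=
    visualAngle_le hn fun z hz => angle_le_two_mul_rhoStarBall hx hy hz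
  by_cases hc : Collinear ℝ ({0, x, y} : Set (EuclideanSpace ℝ (Fin n)))
  · obtain ⟨e, s, t, he, rfl, rfl⟩ := exists_eq_smul_of_collinear hn hc
    obtain ⟨z, hz, hle⟩ := exists_rhoStarBall_smul_le_angle hn hx hy he
    have h1 := hle.trans (angle_le_visualAngle hz)
    have h2 := visualAngle_le hn fun z hz => angle_le_rhoStarBall_smul hx hy he hz
    exact ⟨h1, hupper, fun _ => Or.inl hc, fun _ => le_antisymm h1 h2⟩
  · obtain ⟨z, hz, hlt⟩ := exists_rhoStarBall_lt_angle hx hy hc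
    have h1 := hlt.trans_le (angle_le_visualAngle hz)
    refine ⟨h1.le, hupper, fun h => absurd h h1.ne, ?_⟩
    rintro (h | rfl | rfl)
    · exact absurd h hc
    · exact absurd (by simpa using collinear_pair ℝ 0 y) hc
    · exact absurd (by simpa [Set.pair_comm] using collinear_pair ℝ 0 x) hc
end

section
/- Let n ≥ 2 and let Bⁿ be the open unit ball in ℝⁿ. For x,y ∈ Bⁿ, the equality tan(v_{Bⁿ}(x,y)) = sinh(ρ_{Bⁿ}(x,y)/2) holds if and only if the points 0, x, y are collinear or x = 0 or y = 0. -/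
open EuclideanGeometry Real Set

open scoped RealInnerProductSpace

/-- For `a = ‖x‖²`, `b = ‖y‖²`, `p = ⟪x, y⟫` with `x`, `y` linearly independent, the points `z` of
the unit circle of their plane on the hyperbolic perpendicular bisector of `x` and `y` satisfy
`‖x - z‖² = t (1 - a)` and `‖y - z‖² = t (1 - b)`, where `t` is a root of a quadratic equation;
the smaller root gives a large visual angle. -/
lemma exists_bisector_root {a b p : ℝ} (ha : 0 < a) (ha1 : a < 1) (hb : 0 < b) (hb1 : b < 1)
    (hp : p ^ 2 < a * b) :
    ∃ t : ℝ, 0 < t ∧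
      ((a - b) ^ 2 + (1 - a) * (1 - b) * (a + b - 2 * p)) * t ^ 2
        - 2 * (1 - a * b) * (a + b - 2 * p) * t + (1 + a * b - 2 * p) * (a + b - 2 * p) = 0 ∧
      √(1 + a * b - 2 * p) * ((2 - a - b) * t - (a + b - 2 * p)) < 2 * t * ((1 - a) * (1 - b)) := by
  have hD : 0 < a + b - 2 * p := by
    have h : 2 * p < a + b := lt_of_pow_lt_pow_left₀ 2 (by positivity)
      (by nlinarith [sq_nonneg (a - b)])
    linarith
  have hAB : 0 < (1 - a) * (1 - b) := mul_pos (by linarith) (by linarith)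
  have hN : 0 < 1 + a * b - 2 * p := by nlinarith
  have hab : 0 < 1 - a * b := by nlinarith
  set k := √(1 + a * b - 2 * p) with hk
  have hk0 : 0 < k := Real.sqrt_pos.2 hN
  have hk2 : k ^ 2 = 1 + a * b - 2 * p := Real.sq_sqrt hN.le
  have hk1 : 1 - p < k := Real.lt_sqrt_of_sq_lt (by nlinarith)
  set h := √(4 * ((1 - a) * (1 - b)) * (a * b - p ^ 2) / (a + b - 2 * p)) with hh
  have hh0 : 0 ≤ h := Real.sqrt_nonneg _
  have hh2 : h ^ 2 * (a + b - 2 * p) = 4 * ((1 - a) * (1 - b)) * (a * b - p ^ 2) := by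
    rw [hh, Real.sq_sqrt (div_nonneg (mul_nonneg (by positivity) (by linarith)) hD.le)]
    exact div_mul_cancel₀ _ hD.ne'
  have hm : 0 < 1 - a * b + h := by linarith
  refine ⟨(1 + a * b - 2 * p) / (1 - a * b + h), by positivity, ?_, ?_⟩
  · field_simp
    linear_combination (1 + a * b - 2 * p) * hh2
  · have key : (2 - a - b) * k ^ 2 - (a + b - 2 * p) * (1 - a * b + h)
        < 2 * k * ((1 - a) * (1 - b)) := by
      have h1 : k ^ 2 - 2 * k + 1 - a * b < 0 := by linarith
      have h2 := mul_neg_of_pos_of_neg hAB h1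
      have h3 : a + b - 2 * p = k ^ 2 - (1 - a) * (1 - b) := by rw [hk2]; ring
      have h4 := mul_nonneg hD.le hh0
      have h5 : (a + b - 2 * p) * (1 - a * b + h) = (k ^ 2 - (1 - a) * (1 - b)) * (1 - a * b)
        + (a + b - 2 * p) * h := by rw [← h3]; ring
      rw [h5]
      nlinarith
    have := mul_lt_mul_of_pos_left key (div_pos hk0 hm)
    rw [← hk2]
    calc _ = k / (1 - a * b + h) *
          ((2 - a - b) * k ^ 2 - (a + b - 2 * p) * (1 - a * b + h)) := by
            field_simp
      _ < _ := this
      _ = _ := by field_simp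

section

variable {E : Type*} [NormedAddCommGroup E] [InnerProductSpace ℝ E]

lemma cos_arctan_dist_div (x y : E) (hx : ‖x‖ < 1) (hy : ‖y‖ < 1) :
    Real.cos (Real.arctan (dist x y / √((1 - ‖x‖ ^ 2) * (1 - ‖y‖ ^ 2)))) =
      √((1 - ‖x‖ ^ 2) * (1 - ‖y‖ ^ 2)) / √(1 + ‖x‖ ^ 2 * ‖y‖ ^ 2 - 2 * ⟪x, y⟫) := by
  have hAB : 0 < (1 - ‖x‖ ^ 2) * (1 - ‖y‖ ^ 2) :=
    mul_pos (by nlinarith [norm_nonneg x]) (by nlinarith [norm_nonneg y])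
  rw [Real.cos_arctan, div_pow, Real.sq_sqrt hAB.le, dist_eq_norm, norm_sub_sq_real]
  rw [show 1 + (‖x‖ ^ 2 - 2 * ⟪x, y⟫ + ‖y‖ ^ 2) / ((1 - ‖x‖ ^ 2) * (1 - ‖y‖ ^ 2)) =
    (1 + ‖x‖ ^ 2 * ‖y‖ ^ 2 - 2 * ⟪x, y⟫) / ((1 - ‖x‖ ^ 2) * (1 - ‖y‖ ^ 2)) by
      have := hAB.ne'
      rw [eq_div_iff this, add_mul, div_mul_cancel₀ _ this]; ring]
  rw [Real.sqrt_div' _ hAB.le, one_div_div]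

lemma sq_inner_lt_of_not_collinear {x y : E} (h : ¬ Collinear ℝ ({0, x, y} : Set E)) :
    ⟪x, y⟫ ^ 2 < ‖x‖ ^ 2 * ‖y‖ ^ 2 := by
  by_contra! hle
  apply h
  by_cases hy : y = 0
  · subst hy
    rw [show ({0, x, 0} : Set E) = {0, x} by ext; simp; tauto]
    exact collinear_pair ℝ 0 x
  have hy2 : ‖y‖ ^ 2 ≠ 0 := by simpa using hy
  have hv : ‖(‖y‖ ^ 2) • x - ⟪x, y⟫ • y‖ ^ 2 ≤ 0 := by
    rw [norm_sub_sq_real, norm_smul, norm_smul, real_inner_smul_left, real_inner_smul_right,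
      mul_pow, mul_pow, Real.norm_eq_abs, Real.norm_eq_abs, sq_abs, sq_abs]
    nlinarith [sq_nonneg ‖y‖]
  have hv0 : (‖y‖ ^ 2) • x - ⟪x, y⟫ • y = 0 := by
    rw [← norm_eq_zero]
    exact pow_eq_zero_iff (two_ne_zero) |>.1 (le_antisymm hv (sq_nonneg _))
  have hx : x = (⟪x, y⟫ / ‖y‖ ^ 2) • y := by
    rw [div_eq_inv_mul, mul_smul, ← sub_eq_zero.1 hv0, smul_smul, inv_mul_cancel₀ hy2, one_smul]
  rw [collinear_iff_of_mem (p₀ := (0 : E)) (by simp)]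
  refine ⟨y, fun q hq => ?_⟩
  simp only [mem_insert_iff, mem_singleton_iff] at hq
  rcases hq with rfl | rfl | rfl
  · exact ⟨0, by simp⟩
  · exact ⟨_, by simpa using hx⟩
  · exact ⟨1, by simp⟩

lemma exists_arctan_lt_angle {x y : E} (hx : ‖x‖ < 1) (hy : ‖y‖ < 1)
    (h : ¬ Collinear ℝ ({0, x, y} : Set E)) :
    ∃ z : E, ‖z‖ = 1 ∧
      Real.arctan (dist x y / √((1 - ‖x‖ ^ 2) * (1 - ‖y‖ ^ 2))) < ∠ x z y := by
  have hp := sq_inner_lt_of_not_collinear h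
  have hx0 : 0 < ‖x‖ ^ 2 := by
    by_contra! h0
    nlinarith [sq_nonneg ‖x‖, sq_nonneg ‖y‖, sq_nonneg ⟪x, y⟫]
  have hy0 : 0 < ‖y‖ ^ 2 := by
    by_contra! h0
    nlinarith [sq_nonneg ‖x‖, sq_nonneg ‖y‖, sq_nonneg ⟪x, y⟫]
  have hx1 : ‖x‖ ^ 2 < 1 := by nlinarith [norm_nonneg x]
  have hy1 : ‖y‖ ^ 2 < 1 := by nlinarith [norm_nonneg y]
  obtain ⟨t, ht, hquad, hlt⟩ := exists_bisector_root hx0 hx1 hy0 hy1 hp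
  have hcos := cos_arctan_dist_div x y hx hy
  have hxx := real_inner_self_eq_norm_sq x
  have hyy := real_inner_self_eq_norm_sq y
  have hyx := real_inner_comm x y
  set a := ‖x‖ ^ 2 with ha
  set b := ‖y‖ ^ 2 with hb
  set p := ⟪x, y⟫ with hpdef
  have hg : a * b - p ^ 2 ≠ 0 := by linarith
  obtain ⟨q, hq⟩ : ∃ q, q = ((1 + a) - t * (1 - a)) / 2 := ⟨_, rfl⟩
  obtain ⟨r, hr⟩ : ∃ r, r = ((1 + b) - t * (1 - b)) / 2 := ⟨_, rfl⟩
  obtain ⟨z, hz⟩ : ∃ z, z = ((q * b - r * p) / (a * b - p ^ 2)) • x +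
      ((r * a - q * p) / (a * b - p ^ 2)) • y := ⟨_, rfl⟩
  have hxz : ⟪x, z⟫ = q := by
    rw [hz, inner_add_right, real_inner_smul_right, real_inner_smul_right, hxx, ← hpdef,
      div_mul_eq_mul_div, div_mul_eq_mul_div, ← add_div, div_eq_iff hg]
    ring
  have hyz : ⟪y, z⟫ = r := by
    rw [hz, inner_add_right, real_inner_smul_right, real_inner_smul_right, hyy, hyx,
      div_mul_eq_mul_div, div_mul_eq_mul_div, ← add_div, div_eq_iff hg]
    ring
  have hzz : ‖z‖ ^ 2 = 1 := by
    rw [← real_inner_self_eq_norm_sq]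
    nth_rewrite 1 [hz]
    rw [inner_add_left, real_inner_smul_left, real_inner_smul_left, hxz, hyz, hq, hr]
    field_simp
    linear_combination hquad
  have hxzn : ‖x - z‖ ^ 2 = t * (1 - a) := by
    rw [norm_sub_sq_real, hzz, hxz, hq]; ring
  have hyzn : ‖y - z‖ ^ 2 = t * (1 - b) := by
    rw [norm_sub_sq_real, hzz, hyz, hr]; ring
  have hprod : ‖x - z‖ * ‖y - z‖ = t * √((1 - a) * (1 - b)) := by
    rw [← sq_eq_sq₀ (by positivity) (by positivity), mul_pow, mul_pow, hxzn, hyzn,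
      Real.sq_sqrt (mul_nonneg (by linarith) (by linarith))]
    ring
  have hin : ⟪x - z, y - z⟫ = ((2 - a - b) * t - (a + b - 2 * p)) / 2 := by
    rw [inner_sub_left, inner_sub_right, inner_sub_right, real_inner_self_eq_norm_sq, hzz, hxz,
      real_inner_comm y z, hyz, ← hpdef, hq, hr]
    ring
  refine ⟨z, by nlinarith [norm_nonneg z], ?_⟩
  have hAB : 0 < (1 - a) * (1 - b) := mul_pos (by linarith) (by linarith)
  have hAB2 := Real.sq_sqrt hAB.le
  have hs : 0 < √((1 - a) * (1 - b)) := Real.sqrt_pos.2 hAB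
  have hD : 0 ≤ a + b - 2 * p := by
    have : a + b - 2 * p = ‖x - y‖ ^ 2 := by rw [norm_sub_sq_real]; ring
    exact this ▸ sq_nonneg _
  have hk : 0 < √(1 + a * b - 2 * p) := Real.sqrt_pos.2 (by linarith)
  have hc : Real.cos (∠ x z y) <
      Real.cos (Real.arctan (dist x y / √((1 - a) * (1 - b)))) := by
    have hang : Real.cos (∠ x z y) * (‖x - z‖ * ‖y - z‖) = ⟪x - z, y - z⟫ :=
      InnerProductGeometry.cos_angle_mul_norm_mul_norm (x - z) (y - z)
    rw [hprod, hin] at hang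
    rw [hcos, lt_div_iff₀ hk]
    generalize Real.cos (∠ x z y) = C at hang ⊢
    clear_value a b p
    refine lt_of_mul_lt_mul_right ?_ (mul_pos ht hs).le
    calc _ = √(1 + a * b - 2 * p) * (C * (t * √((1 - a) * (1 - b)))) := by ring
      _ < t * √((1 - a) * (1 - b)) ^ 2 := by rw [hang, hAB2]; linarith
      _ = _ := by ring
  refine (Real.strictAntiOn_cos.lt_iff_gt ⟨?_, ?_⟩ ⟨?_, ?_⟩).1 hc
  · exact EuclideanGeometry.angle_nonneg _ _ _
  · exact EuclideanGeometry.angle_le_pi _ _ _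
  · exact Real.arctan_nonneg.2 (by positivity)
  · linarith [Real.arctan_lt_pi_div_two (dist x y / √((1 - a) * (1 - b))), Real.pi_pos]

lemma exists_unit_smul_of_collinear [Nontrivial E] {x y : E}
    (h : Collinear ℝ ({0, x, y} : Set E)) :
    ∃ (e : E) (a b : ℝ), ‖e‖ = 1 ∧ x = a • e ∧ y = b • e := by
  rw [collinear_iff_of_mem (p₀ := (0 : E)) (by simp)] at h
  obtain ⟨v, hv⟩ := h
  obtain ⟨a, ha⟩ := hv x (by simp)
  obtain ⟨b, hb⟩ := hv y (by simp)
  simp only [vadd_eq_add, add_zero] at ha hb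
  by_cases hv0 : v = 0
  · obtain ⟨e, he⟩ := exists_norm_eq E (zero_le_one (α := ℝ))
    exact ⟨e, 0, 0, he, by simp [ha, hv0], by simp [hb, hv0]⟩
  · have hn : ‖v‖ ≠ 0 := norm_ne_zero_iff.2 hv0
    refine ⟨‖v‖⁻¹ • v, a * ‖v‖, b * ‖v‖, by simp [norm_smul, hn], ?_, ?_⟩
    · rw [smul_smul, mul_assoc, mul_inv_cancel₀ hn, mul_one, ha]
    · rw [smul_smul, mul_assoc, mul_inv_cancel₀ hn, mul_one, hb]

lemma exists_unit_inner_eq (hE : 1 < Module.rank ℝ E) {e : E} (he : ‖e‖ = 1) {c : ℝ}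
    (hc : c ∈ Icc (-1 : ℝ) 1) : ∃ z : E, ‖z‖ = 1 ∧ ⟪e, z⟫ = c := by
  have hconn := isPreconnected_sphere hE (0 : E) 1
  have := hconn.intermediate_value (a := -e) (b := e) (by simp [he]) (by simp [he])
    (f := fun z => ⟪e, z⟫) (by fun_prop)
  obtain ⟨z, hz, hzc⟩ := this (by simpa [he] using hc)
  exact ⟨z, by simpa using hz, hzc⟩

lemma angle_smul_smul_unit {e z : E} (he : ‖e‖ = 1) (hz : ‖z‖ = 1) {a b : ℝ}
    (ha : |a| < 1) (hb : |b| < 1) :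
    ∠ (a • e) z (b • e) ≤
      Real.arctan (dist (a • e) (b • e) / √((1 - ‖a • e‖ ^ 2) * (1 - ‖b • e‖ ^ 2))) ∧
    ((1 + a * b) * ⟪e, z⟫ = a + b → ∠ (a • e) z (b • e) =
      Real.arctan (dist (a • e) (b • e) / √((1 - ‖a • e‖ ^ 2) * (1 - ‖b • e‖ ^ 2)))) := by
  have hna : ‖a • e‖ = |a| := by simp [norm_smul, he]
  have hnb : ‖b • e‖ = |b| := by simp [norm_smul, he]
  have hcos := cos_arctan_dist_div (a • e) (b • e) (hna ▸ ha) (hnb ▸ hb)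
  have hee := real_inner_self_eq_norm_sq e
  have hcb := abs_le.1 (abs_real_inner_le_norm e z)
  rw [he, hz, one_mul] at hcb
  obtain ⟨ha1, ha2⟩ := abs_lt.1 ha
  obtain ⟨hb1, hb2⟩ := abs_lt.1 hb
  have hab : 0 < 1 - a * b := by nlinarith
  have hsqrt : √(1 + a ^ 2 * b ^ 2 - 2 * (a * b)) = 1 - a * b := by
    rw [show 1 + a ^ 2 * b ^ 2 - 2 * (a * b) = (1 - a * b) ^ 2 by ring, Real.sqrt_sq hab.le]
  rw [hna, hnb, sq_abs, sq_abs, real_inner_smul_left, real_inner_smul_right, hee, he, one_pow,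
    mul_one, hsqrt] at hcos
  rw [hna, hnb, sq_abs, sq_abs]
  set c := ⟪e, z⟫ with hc
  have hAB : 0 < (1 - a ^ 2) * (1 - b ^ 2) := mul_pos (by nlinarith) (by nlinarith)
  have hxn : ‖a • e - z‖ ^ 2 = 1 + a ^ 2 - 2 * a * c := by
    rw [norm_sub_sq_real, hna, sq_abs, hz, real_inner_smul_left, ← hc]; ring
  have hyn : ‖b • e - z‖ ^ 2 = 1 + b ^ 2 - 2 * b * c := by
    rw [norm_sub_sq_real, hnb, sq_abs, hz, real_inner_smul_left, ← hc]; ring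
  have hin : ⟪a • e - z, b • e - z⟫ = 1 + a * b - (a + b) * c := by
    rw [inner_sub_left, inner_sub_right, inner_sub_right, real_inner_smul_left,
      real_inner_smul_left, real_inner_smul_right, real_inner_smul_right, hee,
      real_inner_self_eq_norm_sq, hz, he, real_inner_comm e z, ← hc]; ring
  have hI : 0 < 1 + a * b - (a + b) * c := by
    have hM := mul_pos (sub_pos.2 ha2) (sub_pos.2 hb2)
    have hP := mul_pos (neg_lt_iff_pos_add.1 ha1) (neg_lt_iff_pos_add.1 hb1)
    have h1 := mul_nonneg (sub_nonneg.2 hcb.2) hP.le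
    have h2 := mul_nonneg (neg_le_iff_add_nonneg.1 hcb.1) hM.le
    rcases le_total 0 c with h0 | h0
    · linarith [mul_nonneg h0 hM.le]
    · linarith [mul_nonneg (neg_nonneg.2 h0) hP.le]
  have hx0 : 0 < ‖a • e - z‖ := by
    rw [norm_pos_iff, sub_ne_zero]
    rintro h
    rw [← h, hna] at hz
    linarith
  have hy0 : 0 < ‖b • e - z‖ := by
    rw [norm_pos_iff, sub_ne_zero]
    rintro h
    rw [← h, hnb] at hz
    linarith
  have hcang : Real.cos (∠ (a • e) z (b • e)) =
      (1 + a * b - (a + b) * c) / (‖a • e - z‖ * ‖b • e - z‖) := by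
    rw [← hin]; exact InnerProductGeometry.cos_angle _ _
  have hθ : Real.arctan (dist (a • e) (b • e) / √((1 - a ^ 2) * (1 - b ^ 2))) ∈ Icc 0 π :=
    ⟨Real.arctan_nonneg.2 (by positivity), by
      linarith [Real.arctan_lt_pi_div_two (dist (a • e) (b • e) / √((1 - a ^ 2) * (1 - b ^ 2))),
        Real.pi_pos]⟩
  have hφ : ∠ (a • e) z (b • e) ∈ Icc 0 π :=
    ⟨EuclideanGeometry.angle_nonneg _ _ _, EuclideanGeometry.angle_le_pi _ _ _⟩
  have hid : ((1 + a * b - (a + b) * c) * (1 - a * b)) ^ 2 -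
      (√((1 - a ^ 2) * (1 - b ^ 2)) * (‖a • e - z‖ * ‖b • e - z‖)) ^ 2 =
        ((a - b) * ((1 + a * b) * c - (a + b))) ^ 2 := by
    rw [mul_pow (√_), mul_pow ‖_‖, hxn, hyn, Real.sq_sqrt hAB.le]
    ring
  constructor
  · refine (Real.strictAntiOn_cos.le_iff_ge hθ hφ).1 ?_
    rw [hcos, hcang, div_le_div_iff₀ hab (by positivity)]
    refine (sq_le_sq₀ (by positivity) (by positivity)).1 ?_
    linarith [sq_nonneg ((a - b) * ((1 + a * b) * c - (a + b)))]
  · intro h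
    refine Real.injOn_cos hφ hθ ?_
    rw [hcos, hcang, div_eq_div_iff (by positivity) hab.ne']
    rw [h, sub_self, mul_zero, zero_pow two_ne_zero, sub_eq_zero] at hid
    exact (sq_eq_sq₀ (by positivity) (by positivity)).1 hid

end

theorem stmt7 (n : ℕ) (hn : 2 ≤ n) :
    ∀ x ∈ Metric.ball (0 : EuclideanSpace ℝ (Fin n)) 1,
      ∀ y ∈ Metric.ball (0 : EuclideanSpace ℝ (Fin n)) 1,
        (Real.tan (visualAngle (Metric.ball 0 1) x y) = Real.sinh (rhoBall x y / 2) ↔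
          Collinear ℝ ({0, x, y} : Set (EuclideanSpace ℝ (Fin n))) ∨ x = 0 ∨ y = 0) := by
  intro x hx y hy
  rw [mem_ball_zero_iff] at hx hy
  have hcol : (Collinear ℝ ({0, x, y} : Set (EuclideanSpace ℝ (Fin n))) ∨ x = 0 ∨ y = 0) ↔
      Collinear ℝ ({0, x, y} : Set (EuclideanSpace ℝ (Fin n))) := by
    refine ⟨?_, Or.inl⟩
    rintro (h | rfl | rfl)
    · exact h
    · simpa using collinear_pair ℝ 0 y
    · rw [insert_comm]
      simpa using collinear_pair ℝ x 0
  have hrank : 1 < Module.rank ℝ (EuclideanSpace ℝ (Fin n)) := by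
    rw [← Module.finrank_eq_rank, finrank_euclideanSpace_fin]
    exact_mod_cast hn
  have : Nontrivial (EuclideanSpace ℝ (Fin n)) := by
    rw [← rank_pos_iff_nontrivial (R := ℝ)]
    exact zero_lt_one.trans hrank
  have hsinh : Real.sinh (rhoBall x y / 2) =
      dist x y / √((1 - ‖x‖ ^ 2) * (1 - ‖y‖ ^ 2)) := by
    rw [rhoBall, mul_div_cancel_left₀ _ (two_ne_zero), Real.sinh_arsinh]
  have hbdd : BddAbove ((fun z => ∠ x z y) '' Metric.sphere (0 : EuclideanSpace ℝ (Fin n)) 1) := by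
    refine ⟨π, ?_⟩
    rintro _ ⟨z, -, rfl⟩
    exact EuclideanGeometry.angle_le_pi _ _ _
  rw [hcol, hsinh, visualAngle, frontier_ball _ one_ne_zero]
  constructor
  · intro heq
    by_contra h
    have hxy : x ≠ y := by
      rintro rfl
      exact h (by simpa using collinear_pair ℝ 0 x)
    have hS : 0 < dist x y / √((1 - ‖x‖ ^ 2) * (1 - ‖y‖ ^ 2)) :=
      div_pos (dist_pos.2 hxy) (Real.sqrt_pos.2
        (mul_pos (by nlinarith [norm_nonneg x]) (by nlinarith [norm_nonneg y])))
    obtain ⟨z, hz, hlt⟩ := exists_arctan_lt_angle hx hy h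
    have hle := hlt.trans_le (le_csSup hbdd ⟨z, by simpa using hz, rfl⟩)
    have hpi : sSup ((fun z => ∠ x z y) '' Metric.sphere (0 : EuclideanSpace ℝ (Fin n)) 1) ≤ π := by
      refine csSup_le ⟨_, z, by simpa using hz, rfl⟩ ?_
      rintro _ ⟨z, -, rfl⟩
      exact EuclideanGeometry.angle_le_pi _ _ _
    set v := sSup ((fun z => ∠ x z y) '' Metric.sphere (0 : EuclideanSpace ℝ (Fin n)) 1)
    rcases lt_or_ge v (π / 2) with hv | hv
    · have := Real.tan_lt_tan_of_lt_of_lt_pi_div_two (Real.neg_pi_div_two_lt_arctan _) hv hle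
      rw [Real.tan_arctan] at this
      exact this.ne' heq
    · have : Real.tan v ≤ 0 := by
        rw [← Real.tan_sub_pi]
        exact Real.tan_nonpos_of_nonpos_of_neg_pi_div_two_le (by linarith) (by linarith)
      linarith
  · intro h
    obtain ⟨e, a, b, he, rfl, rfl⟩ := exists_unit_smul_of_collinear h
    have ha : |a| < 1 := by simpa [norm_smul, he] using hx
    have hb : |b| < 1 := by simpa [norm_smul, he] using hy
    obtain ⟨ha1, ha2⟩ := abs_lt.1 ha
    obtain ⟨hb1, hb2⟩ := abs_lt.1 hb
    have hP : 0 < 1 + a * b := by nlinarith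
    obtain ⟨z, hz, hzc⟩ := exists_unit_inner_eq hrank he (c := (a + b) / (1 + a * b))
      ⟨by rw [le_div_iff₀ hP]; nlinarith, by rw [div_le_iff₀ hP]; nlinarith⟩
    have hgr : IsGreatest ((fun z => ∠ (a • e) z (b • e)) ''
        Metric.sphere (0 : EuclideanSpace ℝ (Fin n)) 1)
        (Real.arctan (dist (a • e) (b • e) / √((1 - ‖a • e‖ ^ 2) * (1 - ‖b • e‖ ^ 2)))) := by
      refine ⟨⟨z, by simpa using hz, (angle_smul_smul_unit he hz ha hb).2 ?_⟩, ?_⟩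
      · rw [hzc]; field_simp
      · rintro _ ⟨w, hw, rfl⟩
        exact (angle_smul_smul_unit he (by simpa using hw) ha hb).1
    rw [hgr.csSup_eq, Real.tan_arctan]
end

section
/- Let n ≥ 2 and let Bⁿ be the open unit ball in ℝⁿ. For all x,y ∈ Bⁿ one has v_{Bⁿ}(x,y) ≤ 2·arctan( |x−y|·(2−|x−y|) / (2·√((1−|x|²)(1−|y|²))) ). Moreover, equality holds if there exists θ ∈ (0,π/2) with θ = ∠(x,0,y)/2 and |x| = |y| = 1/(sin θ + cos θ). -/
open EuclideanGeometry Real Set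

/-- A weighted estimate for the powers of two points with respect to the unit sphere, in terms of
their positions relative to a point of the sphere. -/
lemma weighted_power_le {E : Type*} [NormedAddCommGroup E] [InnerProductSpace ℝ E]
    {x y z : E} (hz : ‖z‖ = 1) (l m : ℝ) :
    l * (1 - ‖x‖ ^ 2) + m * (1 - ‖y‖ ^ 2) ≤
      2 * ‖l • (x - z) + m • (y - z)‖ - (l * ‖x - z‖ ^ 2 + m * ‖y - z‖ ^ 2) := by
  have h := (abs_le.mp (abs_real_inner_le_norm (l • (x - z) + m • (y - z)) z)).1
  simp only [inner_add_left, inner_sub_left, inner_smul_left, hz, real_inner_self_eq_norm_sq,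
    conj_trivial, mul_one, one_pow] at h
  rw [norm_sub_sq_real, norm_sub_sq_real, hz]
  linarith

lemma norm_smul_add_smul_sq {E : Type*} [NormedAddCommGroup E] [InnerProductSpace ℝ E]
    (p q : E) (l m : ℝ) :
    ‖l • p + m • q‖ ^ 2 =
      l ^ 2 * ‖p‖ ^ 2 + m ^ 2 * ‖q‖ ^ 2 + 2 * (l * m) * inner ℝ p q := by
  rw [norm_add_sq_real, norm_smul, norm_smul, mul_pow, mul_pow, inner_smul_left,
    inner_smul_right]
  simp only [Real.norm_eq_abs, sq_abs, conj_trivial]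
  ring

/-- The weighted inequality between arithmetic and geometric means for two numbers. -/
lemma two_mul_mul_sqrt_le {f g k l m : ℝ} (hf : 0 ≤ f) (hg : 0 ≤ g) (hl : 0 ≤ l) (hm : 0 ≤ m)
    (hk : k ^ 2 ≤ l * m) : 2 * (k * √(f * g)) ≤ l * f + m * g := by
  have h : √(f * g) ^ 2 = f * g := Real.sq_sqrt (mul_nonneg hf hg)
  apply le_of_sq_le_sq _ (by positivity)
  nlinarith [mul_le_mul_of_nonneg_right hk (mul_nonneg hf hg), sq_nonneg (l * f - m * g)]

/-- The half-angle estimate at a point of the unit sphere seeing `x`, `y` under an acute angle. -/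
lemma half_angle_estimate_acute {E : Type*} [NormedAddCommGroup E] [InnerProductSpace ℝ E]
    {x y z : E} (hx : ‖x‖ < 1) (hy : ‖y‖ < 1) (hz : ‖z‖ = 1) {s c : ℝ} (hs : 0 ≤ s) (hc : 0 ≤ c)
    (hsc : s ^ 2 + c ^ 2 = 1)
    (hi : inner ℝ (x - z) (y - z) = ‖x - z‖ * ‖y - z‖ * (c ^ 2 - s ^ 2)) (hle : s ≤ c) :
    2 * √((1 - ‖x‖ ^ 2) * (1 - ‖y‖ ^ 2)) * s ≤ ‖x - y‖ * (2 - ‖x - y‖) * c := by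
  have hf : 0 ≤ 1 - ‖x‖ ^ 2 := by nlinarith [norm_nonneg x]
  have hg : 0 ≤ 1 - ‖y‖ ^ 2 := by nlinarith [norm_nonneg y]
  have hd2 : ‖x - y‖ ≤ 2 := by linarith [norm_sub_le x y]
  have h1 := weighted_power_le (x := x) (y := y) hz 1 1
  have h2 := two_mul_mul_sqrt_le (k := 1) hf hg zero_le_one zero_le_one (by norm_num)
  have hN := norm_smul_add_smul_sq (x - z) (y - z) 1 1
  have hd := norm_smul_add_smul_sq (x - z) (y - z) 1 (-1)
  have he : (1 : ℝ) • (x - z) + (-1 : ℝ) • (y - z) = x - y := by module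
  rw [he, hi] at hd
  rw [hi] at hN
  generalize √((1 - ‖x‖ ^ 2) * (1 - ‖y‖ ^ 2)) = W at *
  have hN0 := norm_nonneg ((1 : ℝ) • (x - z) + (1 : ℝ) • (y - z))
  generalize ‖(1 : ℝ) • (x - z) + (1 : ℝ) • (y - z)‖ = N at *
  have hd0 := norm_nonneg (x - y)
  generalize ‖x - y‖ = d at *
  have ha := norm_nonneg (x - z)
  have hb := norm_nonneg (y - z)
  generalize ‖x - z‖ = a at *
  generalize ‖y - z‖ = b at *
  have hW : W ≤ N - (N ^ 2 + d ^ 2) / 4 := by nlinarith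
  have hNd : N * s ≤ d * c := by
    apply le_of_sq_le_sq _ (by positivity)
    have h3 : (d * c) ^ 2 - (N * s) ^ 2 = (a - b) ^ 2 * (c ^ 2 - s ^ 2) := by
      rw [mul_pow, mul_pow, hN, hd]
      linear_combination (-2 * a * b * (c ^ 2 - s ^ 2)) * hsc
    have h4 : 0 ≤ c ^ 2 - s ^ 2 := by nlinarith
    nlinarith [mul_nonneg (sq_nonneg (a - b)) h4]
  rcases hs.eq_or_lt with rfl | hs
  · have : 0 ≤ d * (2 - d) * c := by
      have : 0 ≤ 2 - d := by linarith
      positivity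
    linarith
  · obtain ⟨k, rfl⟩ : ∃ k, c = k * s := ⟨c / s, by field_simp⟩
    have hk : 1 ≤ k := le_of_mul_le_mul_right (by linarith) hs
    have hNk : N ≤ d * k := le_of_mul_le_mul_right (by linarith) hs
    have key : 2 * W ≤ d * (2 - d) * k := by
      rcases le_total (d * k) 2 with h | h
      · nlinarith [mul_nonneg (sub_nonneg.2 hNk) (by linarith : 0 ≤ 4 - (N + d * k)),
          sq_nonneg (d * (k - 1))]
      · nlinarith [sq_nonneg (N - 2), mul_nonneg (sub_nonneg.2 h) (sub_nonneg.2 hd2)]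
    nlinarith

/-- The half-angle estimate at a point of the unit sphere seeing `x`, `y` under an obtuse angle.
The weights are those for which the combination of `x - z` and `y - z` points from `z` to the
circumcenter of the triangle `x`, `y`, `z`. -/
lemma half_angle_estimate_obtuse {E : Type*} [NormedAddCommGroup E] [InnerProductSpace ℝ E]
    {x y z : E} (hx : ‖x‖ < 1) (hy : ‖y‖ < 1) (hz : ‖z‖ = 1) {s c : ℝ} (hc : 0 ≤ c)
    (hsc : s ^ 2 + c ^ 2 = 1)
    (hi : inner ℝ (x - z) (y - z) = ‖x - z‖ * ‖y - z‖ * (c ^ 2 - s ^ 2)) (hle : c < s) :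
    2 * √((1 - ‖x‖ ^ 2) * (1 - ‖y‖ ^ 2)) * s ≤ ‖x - y‖ * (2 - ‖x - y‖) * c := by
  have hs : 0 < s := hc.trans_lt hle
  have hf : 0 ≤ 1 - ‖x‖ ^ 2 := by nlinarith [norm_nonneg x]
  have hg : 0 ≤ 1 - ‖y‖ ^ 2 := by nlinarith [norm_nonneg y]
  have ha : 0 < ‖x - z‖ := norm_pos_iff.2 (sub_ne_zero.2 (by rintro rfl; linarith))
  have hb : 0 < ‖y - z‖ := norm_pos_iff.2 (sub_ne_zero.2 (by rintro rfl; linarith))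
  have hd := norm_smul_add_smul_sq (x - z) (y - z) 1 (-1)
  have he : (1 : ℝ) • (x - z) + (-1 : ℝ) • (y - z) = x - y := by module
  rw [he, hi] at hd
  have h1 := weighted_power_le (x := x) (y := y) hz
  have hN := norm_smul_add_smul_sq (x - z) (y - z)
  have hN0 := fun l m : ℝ => norm_nonneg (l • (x - z) + m • (y - z))
  have h2 := fun k l m => two_mul_mul_sqrt_le (k := k) (l := l) (m := m) hf hg
  simp only [hi] at hN
  have hW := Real.sqrt_nonneg ((1 - ‖x‖ ^ 2) * (1 - ‖y‖ ^ 2))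
  generalize √((1 - ‖x‖ ^ 2) * (1 - ‖y‖ ^ 2)) = W at *
  have hd0 := norm_nonneg (x - y)
  generalize ‖x - y‖ = d at *
  generalize ‖x - z‖ = a at *
  generalize ‖y - z‖ = b at *
  obtain ⟨e, he⟩ : ∃ e, e = s ^ 2 - c ^ 2 := ⟨_, rfl⟩
  have he0 : 0 ≤ e := by rw [he]; nlinarith
  have hcs : c ^ 2 - s ^ 2 = -e := by rw [he]; ring
  rw [hcs] at hd
  simp only [hcs] at hN
  set l := b * (a + b * e) with hl
  set m := a * (b + a * e) with hm
  have hnorm : ‖l • (x - z) + m • (y - z)‖ = d * (2 * a * b * s * c) := by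
    rw [← sq_eq_sq₀ (hN0 l m) (by positivity), hN, mul_pow d, hd]
    have h3 : (2 * a * b * s * c) ^ 2 = a ^ 2 * b ^ 2 * (1 - e ^ 2) := by
      rw [he]
      linear_combination (a ^ 2 * b ^ 2 * (1 + s ^ 2 + c ^ 2)) * hsc
    rw [h3, hl, hm]
    ring
  have h3 := h1 l m
  have h4 := h2 (a * b * (1 + e)) l m (by positivity) (by positivity) (by
    rw [hl, hm]
    nlinarith [mul_nonneg (mul_nonneg ha.le hb.le) (mul_nonneg he0 (sq_nonneg (a - b)))])
  have h5 : l * a ^ 2 + m * b ^ 2 = a * b * d ^ 2 := by rw [hl, hm, hd]; ring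
  rw [hnorm, h5] at h3
  have h6 : 1 + e = 2 * s ^ 2 := by rw [he]; linarith
  rw [h6] at h4
  have h7 : a * b * (4 * s ^ 2 * W) ≤ a * b * (4 * d * s * c - d ^ 2) := by linarith
  have h8 := le_of_mul_le_mul_left h7 (by positivity)
  have h9 : 2 * s * c ≤ 1 := by nlinarith [sq_nonneg (s - c)]
  have h10 : d ^ 2 * (2 * s * c) ≤ d ^ 2 * 1 := mul_le_mul_of_nonneg_left h9 (by positivity)
  exact le_of_mul_le_mul_left (a := 2 * s) (by linarith) (by positivity)

lemma half_angle_estimate {E : Type*} [NormedAddCommGroup E] [InnerProductSpace ℝ E]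
    {x y z : E} (hx : ‖x‖ < 1) (hy : ‖y‖ < 1) (hz : ‖z‖ = 1) :
    2 * √((1 - ‖x‖ ^ 2) * (1 - ‖y‖ ^ 2)) * sin (∠ x z y / 2) ≤
      dist x y * (2 - dist x y) * cos (∠ x z y / 2) := by
  have h0 : 0 ≤ ∠ x z y := angle_nonneg _ _ _
  have hpi : ∠ x z y ≤ π := angle_le_pi _ _ _
  have hs : 0 ≤ sin (∠ x z y / 2) := sin_nonneg_of_nonneg_of_le_pi (by linarith) (by linarith)
  have hc : 0 ≤ cos (∠ x z y / 2) := cos_nonneg_of_mem_Icc ⟨by linarith, by linarith⟩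
  have hi : inner ℝ (x - z) (y - z) =
      ‖x - z‖ * ‖y - z‖ * (cos (∠ x z y / 2) ^ 2 - sin (∠ x z y / 2) ^ 2) := by
    rw [← cos_two_mul', mul_div_cancel₀ _ two_ne_zero, mul_comm]
    exact (InnerProductGeometry.cos_angle_mul_norm_mul_norm (x - z) (y - z)).symm
  rw [dist_eq_norm]
  rcases le_or_gt (sin (∠ x z y / 2)) (cos (∠ x z y / 2)) with h | h
  · exact half_angle_estimate_acute hx hy hz hs hc (sin_sq_add_cos_sq _) hi h
  · exact half_angle_estimate_obtuse hx hy hz hc (sin_sq_add_cos_sq _) hi h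

lemma angle_le_two_mul_arctan {E : Type*} [NormedAddCommGroup E] [InnerProductSpace ℝ E]
    {x y z : E} (hx : ‖x‖ < 1) (hy : ‖y‖ < 1) (hz : ‖z‖ = 1) :
    ∠ x z y ≤ 2 * arctan (dist x y * (2 - dist x y) /
      (2 * √((1 - ‖x‖ ^ 2) * (1 - ‖y‖ ^ 2)))) := by
  have hf : 0 < 1 - ‖x‖ ^ 2 := by nlinarith [norm_nonneg x]
  have hg : 0 < 1 - ‖y‖ ^ 2 := by nlinarith [norm_nonneg y]
  have hW : 0 < √((1 - ‖x‖ ^ 2) * (1 - ‖y‖ ^ 2)) := Real.sqrt_pos.2 (mul_pos hf hg)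
  have key := half_angle_estimate hx hy hz
  have h0 : 0 ≤ ∠ x z y := angle_nonneg _ _ _
  have hlt : ∠ x z y < π := by
    refine (angle_le_pi _ _ _).lt_of_ne fun h => ?_
    rw [h, sin_pi_div_two, cos_pi_div_two] at key
    linarith
  have hc : 0 < cos (∠ x z y / 2) := cos_pos_of_mem_Ioo ⟨by linarith, by linarith⟩
  have htan : tan (∠ x z y / 2) ≤ dist x y * (2 - dist x y) /
      (2 * √((1 - ‖x‖ ^ 2) * (1 - ‖y‖ ^ 2))) := by
    rw [tan_eq_sin_div_cos, div_le_div_iff₀ hc (by positivity)]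
    linarith
  have := arctan_strictMono.monotone htan
  rw [arctan_tan (by linarith) (by linarith)] at this
  linarith

/-- Two points of equal norm `1 / (sin θ + cos θ)` at central angle `2 * θ` are seen under a right
angle from the point of the unit sphere in the direction of their midpoint. -/
lemma exists_angle_eq_pi_div_two {E : Type*} [NormedAddCommGroup E] [InnerProductSpace ℝ E]
    {x y : E} {θ : ℝ} (hθ : θ ∈ Set.Ioo 0 (π / 2)) (hxy : θ = ∠ x 0 y / 2)
    (hx : ‖x‖ = 1 / (sin θ + cos θ)) (hy : ‖y‖ = 1 / (sin θ + cos θ)) :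
    (∃ z : E, ‖z‖ = 1 ∧ ∠ x z y = π / 2) ∧
      dist x y * (2 - dist x y) / (2 * √((1 - ‖x‖ ^ 2) * (1 - ‖y‖ ^ 2))) = 1 := by
  have hs : 0 < sin θ := sin_pos_of_pos_of_lt_pi hθ.1 (by linarith [hθ.2, pi_pos])
  have hc : 0 < cos θ := cos_pos_of_mem_Ioo ⟨by linarith [hθ.1, pi_pos], hθ.2⟩
  have hsc := sin_sq_add_cos_sq θ
  have hi : inner ℝ x y = ‖x‖ * ‖y‖ * (cos θ ^ 2 - sin θ ^ 2) := by
    rw [← cos_two_mul', hxy, mul_div_cancel₀ _ two_ne_zero, mul_comm]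
    have := (InnerProductGeometry.cos_angle_mul_norm_mul_norm x y).symm
    simpa [EuclideanGeometry.angle] using this
  generalize sin θ = s at *
  generalize cos θ = c at *
  rw [hx, hy] at hi
  obtain ⟨r, hr⟩ : ∃ r, r = 1 / (s + c) := ⟨_, rfl⟩
  have hr0 : 0 < r := by rw [hr]; positivity
  have hr1 : r * (s + c) = 1 := by rw [hr]; field_simp
  rw [← hr] at hx hy hi
  have hsum : ‖x + y‖ = 2 * r * c := by
    rw [← sq_eq_sq₀ (norm_nonneg _) (by positivity), norm_add_sq_real, hx, hy, hi]
    linear_combination (-2 * r ^ 2) * hsc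
  have hd : dist x y = 2 * r * s := by
    rw [dist_eq_norm, ← sq_eq_sq₀ (norm_nonneg _) (by positivity), norm_sub_sq_real, hx, hy, hi]
    linear_combination (-2 * r ^ 2) * hsc
  constructor
  · refine ⟨(2 * r * c)⁻¹ • (x + y), ?_, ?_⟩
    · rw [norm_smul, hsum, Real.norm_of_nonneg (by positivity)]
      field_simp
    · unfold EuclideanGeometry.angle
      rw [← InnerProductGeometry.inner_eq_zero_iff_angle_eq_pi_div_two]
      simp only [vsub_eq_sub, inner_sub_left, inner_sub_right, inner_smul_left, inner_smul_right,
        inner_add_left, inner_add_right, real_inner_self_eq_norm_sq, real_inner_comm x y, hx, hy,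
        hi, conj_trivial]
      obtain ⟨k, hk⟩ : ∃ k, k = (2 * r * c)⁻¹ := ⟨_, rfl⟩
      have hk1 : k * (2 * r * c) = 1 := by rw [hk]; field_simp
      rw [← hk]
      have hg : r * r * (c ^ 2 - s ^ 2) + r ^ 2 = 2 * r ^ 2 * c ^ 2 := by
        linear_combination (-r ^ 2) * hsc
      have hr2 : r ^ 2 * (c ^ 2 - s ^ 2) - 2 * r * c + 1 = 0 := by
        linear_combination (r * (c - s) - 1) * hr1
      linear_combination (2 * k ^ 2 - 2 * k) * hg + hr2 + (k * (2 * r * c) + 1 - 2 * r * c) * hk1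
  · have hpow : 1 - r ^ 2 = 2 * r ^ 2 * s * c := by
      linear_combination (-(1 + r * (s + c))) * hr1 + r ^ 2 * hsc
    rw [hx, hy, Real.sqrt_mul_self (by rw [hpow]; positivity), hpow, hd,
      div_eq_one_iff_eq (by positivity)]
    linear_combination (-4 * r * s) * hr1

theorem stmt9 (n : ℕ) (hn : 2 ≤ n) :
    ∀ x ∈ Metric.ball (0 : EuclideanSpace ℝ (Fin n)) 1,
      ∀ y ∈ Metric.ball (0 : EuclideanSpace ℝ (Fin n)) 1,
        visualAngle (Metric.ball 0 1) x y ≤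
            2 * Real.arctan (dist x y * (2 - dist x y) /
              (2 * Real.sqrt ((1 - ‖x‖ ^ 2) * (1 - ‖y‖ ^ 2)))) ∧
          ((∃ θ ∈ Set.Ioo (0 : ℝ) (π / 2),
              θ = ∠ x (0 : EuclideanSpace ℝ (Fin n)) y / 2 ∧
              ‖x‖ = 1 / (Real.sin θ + Real.cos θ) ∧
              ‖y‖ = 1 / (Real.sin θ + Real.cos θ)) →
            visualAngle (Metric.ball 0 1) x y =
              2 * Real.arctan (dist x y * (2 - dist x y) /
                (2 * Real.sqrt ((1 - ‖x‖ ^ 2) * (1 - ‖y‖ ^ 2))))) := by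
  intro x hx y hy
  rw [mem_ball_zero_iff] at hx hy
  have hfr : frontier (Metric.ball (0 : EuclideanSpace ℝ (Fin n)) 1) = Metric.sphere 0 1 :=
    frontier_ball _ one_ne_zero
  have hle : ∀ z ∈ Metric.sphere (0 : EuclideanSpace ℝ (Fin n)) 1, ∠ x z y ≤
      2 * Real.arctan (dist x y * (2 - dist x y) /
        (2 * Real.sqrt ((1 - ‖x‖ ^ 2) * (1 - ‖y‖ ^ 2)))) := fun z hz =>
    angle_le_two_mul_arctan hx hy (mem_sphere_zero_iff_norm.1 hz)
  have hd2 : 0 ≤ 2 - dist x y := by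
    rw [dist_eq_norm]
    linarith [norm_sub_le x y]
  have hub : visualAngle (Metric.ball 0 1) x y ≤ 2 * Real.arctan (dist x y * (2 - dist x y) /
      (2 * Real.sqrt ((1 - ‖x‖ ^ 2) * (1 - ‖y‖ ^ 2)))) := by
    rw [visualAngle, hfr]
    refine Real.sSup_le ?_ (mul_nonneg zero_le_two (Real.arctan_nonneg.2 (by positivity)))
    rintro _ ⟨z, hz, rfl⟩
    exact hle z hz
  refine ⟨hub, ?_⟩
  rintro ⟨θ, hθ, hxy, hxn, hyn⟩
  obtain ⟨⟨z, hz, hzang⟩, hval⟩ := exists_angle_eq_pi_div_two hθ hxy hxn hyn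
  refine hub.antisymm ?_
  rw [visualAngle, hfr, hval, Real.arctan_one]
  have hbdd : BddAbove ((fun z => ∠ x z y) '' Metric.sphere 0 1) :=
    ⟨π, by rintro _ ⟨w, -, rfl⟩; exact angle_le_pi _ _ _⟩
  have := le_csSup hbdd ⟨z, mem_sphere_zero_iff_norm.2 hz, rfl⟩
  simp only [hzang] at this
  linarith
end
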